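/- Let F be a field of characteristic 2 and E = F(α) a simple quartic extension with normalized minimal polynomial f(X) = X⁴ + aX³ + bX² + cX + d of α (b = 0, a ≠ 0 in the separable case; a = c = 0, b ≠ 0 in the inseparable not purely inseparable case; a = b = c = 0 in the purely inseparable case), and cubic resolvent f_C(X) = X³ + bX² + acX + (a²d + c²). Then the 2-fold quadratic Pfister forms whose Witt class lies in W_q(E/F) are exactly the forms, up to isometry, of the following types: (a') ⟨⟨h,g]] for h ∈ F* and those g ∈ F such that F(℘⁻¹(g)) ⊆ E; (b) ⟨⟨g,h]] for h ∈ F and those g ∈ F* with F(√g) ⊆ E; (c) ⟨⟨f_C(e), d/e²]] for e ∈ F* with f_C(e) ≠ 0. -/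

import Mathlib

open QuadraticMap

variable (F : Type) [Field F]

/-- Quadratic forms on `Fin n → F`. -/
abbrev QF (n : ℕ) := QuadraticForm F (Fin n → F)

/-- The nonsingular binary quadratic form `[a,b] = a x² + x y + b y²`. -/
noncomputable def binQF (a b : F) : QF F 2 :=
  (Matrix.of ![![a, 1], ![0, b]]).toQuadraticMap'

/-- The totally singular diagonal quadratic form `⟨c₁, …, c_n⟩ = Σ cᵢ xᵢ²`. -/
noncomputable def diagQF {n : ℕ} (c : Fin n → F) : QF F n :=
  QuadraticMap.weightedSumSquares F c

/-- Orthogonal sum of a finite family of quadratic forms of the same dimension. -/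
noncomputable def oSumFam {k n : ℕ} (q : Fin k → QF F n) : QF F (k * n) :=
  (QuadraticMap.pi q).comp
    ((LinearEquiv.curry F F (Fin k) (Fin n)).toLinearMap.comp
      (LinearEquiv.funCongrLeft F F finProdFinEquiv).toLinearMap)

/-- Orthogonal sum of two quadratic forms. -/
noncomputable def oSum {n m : ℕ} (q₁ : QF F n) (q₂ : QF F m) : QF F (n + m) :=
  (QuadraticMap.prod q₁ q₂).comp
    ((LinearEquiv.sumArrowLequivProdArrow (Fin n) (Fin m) F F).toLinearMap.comp
      (LinearEquiv.funCongrLeft F F finSumFinEquiv).toLinearMap)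

section General
variable {M N : Type} [AddCommGroup M] [Module F M] [AddCommGroup N] [Module F N]

/-- Two quadratic forms are isometric if there is an isometry (isomorphism preserving the
form) between them. -/
def QIsometric (q₁ : QuadraticForm F M) (q₂ : QuadraticForm F N) : Prop :=
  Nonempty (QuadraticMap.IsometryEquiv q₁ q₂)

/-- `q₁` is dominated by `q₂` (written `q₁ ≺ q₂`) if there is an injective linear map `t`
with `q₁ x = q₂ (t x)` for all `x`. -/
def Dominates (q₁ : QuadraticForm F M) (q₂ : QuadraticForm F N) : Prop :=
  ∃ t : M →ₗ[F] N, Function.Injective t ∧ ∀ x, q₁ x = q₂ (t x)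

/-- A quadratic form is nonsingular if the radical of its polar form is trivial. -/
def Nonsingular (q : QuadraticForm F M) : Prop :=
  ∀ x, (∀ y, polar q x y = 0) → x = 0

/-- A quadratic form is totally singular if its polar form vanishes identically. -/
def TotallySingular (q : QuadraticForm F M) : Prop :=
  ∀ x y, polar q x y = 0

/-- A quadratic form is hyperbolic if it is isometric to an orthogonal sum of
hyperbolic planes `ℍ = [0,0]`. -/
def Hyperbolic (q : QuadraticForm F M) : Prop :=
  ∃ k : ℕ, QIsometric F q (oSumFam F fun _ : Fin k => binQF F 0 0)

/-- Witt equivalence: two quadratic forms are Witt equivalent iff they have isometric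
anisotropic parts, i.e. both are isometric to `i × ℍ ⊥ ρ ⊥ j × ⟨0⟩` for a common
anisotropic form `ρ`. -/
def WittEquiv (q₁ : QuadraticForm F M) (q₂ : QuadraticForm F N) : Prop :=
  ∃ (r : ℕ) (ρ : QF F r), ρ.Anisotropic ∧
    (∃ i j : ℕ, QIsometric F q₁
      (oSum F (oSum F (oSumFam F fun _ : Fin i => binQF F 0 0) ρ) (diagQF F (0 : Fin j → F)))) ∧
    (∃ i j : ℕ, QIsometric F q₂
      (oSum F (oSum F (oSumFam F fun _ : Fin i => binQF F 0 0) ρ) (diagQF F (0 : Fin j → F))))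

end General

/-- The Gram-type matrix of a quadratic form on `Fin n → F`: diagonal entries are the values
on basis vectors, above-diagonal entries the polar values. -/
noncomputable def qMat {n : ℕ} (q : QF F n) : Matrix (Fin n) (Fin n) F :=
  Matrix.of fun i j =>
    if i = j then q (Pi.single i 1)
    else if i < j then polar q (Pi.single i 1) (Pi.single j 1) else 0

/-- Scalar extension of a quadratic form along `F → E`. -/
noncomputable def extQF (E : Type) [CommRing E] [Algebra F E] {n : ℕ} (q : QF F n) :
    QuadraticForm E (Fin n → E) :=
  ((qMat F q).map (algebraMap F E)).toQuadraticMap'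

/-- Membership of the Witt class of `q` in the kernel `W_q(E/F)` of `W_qF → W_qE`:
the scalar extension of `q` is Witt equivalent to the zero form. -/
def InWqKernel (E : Type) [Field E] [Algebra F E] {n : ℕ} (q : QF F n) : Prop :=
  WittEquiv E (extQF F E q) (0 : QF E 0)

/-- The 2-fold quadratic Pfister form `⟨⟨g,h]] = ⟨1,g⟩_b ⊗ [1,h] = [1,h] ⊥ g[1,h]`. -/
noncomputable def pf2 (g h : F) : QF F 4 :=
  oSum F (binQF F 1 h) (g • binQF F 1 h)

/-- The 3-fold quadratic Pfister form `⟨⟨g₁,g₂,h]] = ⟨1,g₁⟩_b ⊗ ⟨1,g₂⟩_b ⊗ [1,h]`. -/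
noncomputable def pf3 (g₁ g₂ h : F) : QF F 8 :=
  oSum F (pf2 F g₂ h) (g₁ • pf2 F g₂ h)

/-- Orthogonal sum of a list of quadratic forms of varying dimensions. -/
noncomputable def listOSum : List (Σ n, QF F n) → Σ n, QF F n
  | [] => ⟨0, 0⟩
  | x :: L => ⟨x.1 + (listOSum L).1, oSum F x.2 (listOSum L).2⟩

/-- The cubic resolvent `f_C(X) = X³ + bX² + acX + (a²d + c²)` of
`f(X) = X⁴ + aX³ + bX² + cX + d`, evaluated at `e`. -/
def cubicResolvent (a b c d e : F) : F := e ^ 3 + b * e ^ 2 + a * c * e + (a ^ 2 * d + c ^ 2)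

theorem toQuadraticForm'_apply {n : ℕ} (M : Matrix (Fin n) (Fin n) F) (v : Fin n → F) :
    M.toQuadraticForm' v = ∑ i, ∑ j, v i * (v j * M i j) := by
  simp [Matrix.toQuadraticForm', Matrix.toLinearMap₂'_apply]

theorem binQF_apply (a b : F) (v : Fin 2 → F) :
    binQF F a b v = a * v 0 ^ 2 + v 0 * v 1 + b * v 1 ^ 2 := by
  refine (toQuadraticForm'_apply F _ v).trans ?_
  simp [Fin.sum_univ_succ]
  ring

theorem oSum_apply {n m : ℕ} (q₁ : QF F n) (q₂ : QF F m) (v : Fin (n + m) → F) :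
    oSum F q₁ q₂ v = q₁ (fun i => v (Fin.castAdd m i)) + q₂ (fun i => v (Fin.natAdd n i)) := by
  rfl

theorem oSumFam_apply {k n : ℕ} (q : Fin k → QF F n) (v : Fin (k * n) → F) :
    oSumFam F q v = ∑ i, q i (fun j => v (finProdFinEquiv (i, j))) := by
  simp [oSumFam, QuadraticMap.pi_apply]
  rfl

theorem pf2_apply (g h : F) (v : Fin 4 → F) :
    pf2 F g h v = v 0 ^ 2 + v 0 * v 1 + h * v 1 ^ 2
      + g * (v 2 ^ 2 + v 2 * v 3 + h * v 3 ^ 2) := by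
  have e : pf2 F g h v = binQF F 1 h ![v 0, v 1] + g * binQF F 1 h ![v 2, v 3] := by
    rw [pf2, oSum_apply, smul_apply, smul_eq_mul]
    congr 2
    ext i
    fin_cases i <;> rfl
  rw [e, binQF_apply, binQF_apply]
  simp

theorem extQF_pf2 (E : Type) [Field E] [Algebra F E] (g h : F) :
    extQF F E (pf2 F g h) = pf2 E (algebraMap F E g) (algebraMap F E h) := by
  ext v
  rw [pf2_apply]
  refine (toQuadraticForm'_apply E _ v).trans ?_
  simp only [Fin.sum_univ_four, qMat, polar, pf2_apply, Matrix.map_apply, Matrix.of_apply]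
  simp
  ring

/-- The quaternion algebra with `i² = i - h`, `j² = -g`, whose norm form is the quadratic Pfister
form `⟨⟨g, h]]`. -/
abbrev QuatAlg (R : Type) [CommRing R] (g h : R) := QuaternionAlgebra R (-h) 1 (-g)

namespace QuatAlg

section CommRing
variable {R : Type} [CommRing R] {g h : R}

/-- The reduced norm. -/
def norm (p : QuatAlg R g h) : R :=
  p.re ^ 2 + p.re * p.imI + h * p.imI ^ 2 + g * (p.imJ ^ 2 + p.imJ * p.imK + h * p.imK ^ 2)

/-- The polar form of the reduced norm. -/
def bil (p q : QuatAlg R g h) : R :=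
  2 * p.re * q.re + p.re * q.imI + p.imI * q.re + 2 * h * p.imI * q.imI +
    g * (2 * p.imJ * q.imJ + p.imJ * q.imK + p.imK * q.imJ + 2 * h * p.imK * q.imK)

theorem norm_add (p q : QuatAlg R g h) : norm (p + q) = norm p + norm q + bil p q := by
  simp [norm, bil]; ring

theorem norm_smul (r : R) (p : QuatAlg R g h) : norm (r • p) = r ^ 2 * norm p := by
  simp [norm]; ring

theorem norm_mul (p q : QuatAlg R g h) : norm (p * q) = norm p * norm q := by
  simp [norm]; ring

@[simp] theorem norm_zero : norm (0 : QuatAlg R g h) = 0 := by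
  simp [norm]

@[simp] theorem norm_one : norm (1 : QuatAlg R g h) = 1 := by
  simp [norm]

theorem star_mul_self_eq (p : QuatAlg R g h) : star p * p = norm p • 1 := by
  ext <;> simp [norm] <;> ring

theorem bil_comm (p q : QuatAlg R g h) : bil p q = bil q p := by
  simp [bil]; ring

theorem bil_add_left (p q r : QuatAlg R g h) : bil (p + q) r = bil p r + bil q r := by
  simp [bil]; ring

theorem bil_add_right (p q r : QuatAlg R g h) : bil p (q + r) = bil p q + bil p r := by
  simp [bil]; ring

theorem bil_smul_left (r : R) (p q : QuatAlg R g h) : bil (r • p) q = r * bil p q := by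
  simp [bil]; ring

theorem bil_smul_right (r : R) (p q : QuatAlg R g h) : bil p (r • q) = r * bil p q := by
  simp [bil]; ring

theorem bil_zero_right (p : QuatAlg R g h) : bil p 0 = 0 := by
  simp [bil]

theorem bil_self (p : QuatAlg R g h) : bil p p = 2 * norm p := by
  simp [bil, norm]; ring

theorem bil_mul_left (p q r : QuatAlg R g h) : bil (p * q) r = bil p (r * star q) := by
  simp [bil]; ring

theorem bil_span_mul (x y s t : R) (w z : QuatAlg R g h) :
    bil (x • 1 + y • w) ((s • 1 + t • w) * z) =
      s * x * bil 1 z + s * y * bil w z + t * x * (bil 1 w * bil 1 z - bil w z)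
        + t * y * norm w * bil 1 z := by
  simp [bil, norm]; ring

end CommRing

section Field
variable {K : Type} [Field K] {g h : K}

/-- The element with coordinates `v`. -/
def ofTuple (g h : K) : (Fin 4 → K) ≃ₗ[K] QuatAlg K g h :=
  (QuaternionAlgebra.linearEquivTuple _ _ _).symm

theorem norm_ofTuple (v : Fin 4 → K) : norm (ofTuple g h v) = pf2 K g h v := by
  rw [pf2_apply]
  rfl

variable [CharP K 2]

theorem bil_self_eq_zero (p : QuatAlg K g h) : bil p p = 0 := by
  rw [bil_self, CharTwo.two_eq_zero, zero_mul]

theorem eq_zero_of_bil (hg : g ≠ 0) {p : QuatAlg K g h} (hp : ∀ q, bil p q = 0) : p = 0 := by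
  have h2 : (2 : K) = 0 := CharTwo.two_eq_zero
  have h0 := hp ⟨1, 0, 0, 0⟩
  have h1 := hp ⟨0, 1, 0, 0⟩
  have hj := hp ⟨0, 0, 1, 0⟩
  have hk := hp ⟨0, 0, 0, 1⟩
  simp [bil, h2, hg] at h0 h1 hj hk
  ext <;> simp [*]

theorem exists_bil_ne_zero (hg : g ≠ 0) {p : QuatAlg K g h} (hp : p ≠ 0) : ∃ q, bil p q ≠ 0 := by
  by_contra! H
  exact hp (eq_zero_of_bil hg H)

/-- An element of trace one has a complementary orthogonal element of nonzero norm. -/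
theorem exists_orthogonal (hg : g ≠ 0) (w : QuatAlg K g h) (hw : bil 1 w = 1) :
    ∃ z, bil 1 z = 0 ∧ bil w z = 0 ∧ norm z ≠ 0 := by
  have hw' : bil w 1 = 1 := by rw [bil_comm, hw]
  let P : QuatAlg K g h → QuatAlg K g h := fun x => x + bil w x • 1 + bil 1 x • w
  have P1 : ∀ x, bil 1 (P x) = 0 := fun x => by
    simp only [P, bil_add_right, bil_smul_right, bil_self_eq_zero, hw]
    linear_combination bil 1 x * CharTwo.two_eq_zero (R := K)
  have Pw : ∀ x, bil w (P x) = 0 := fun x => by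
    simp only [P, bil_add_right, bil_smul_right, bil_self_eq_zero, hw']
    linear_combination bil w x * CharTwo.two_eq_zero (R := K)
  by_contra! H
  have hP : ∀ x, norm (P x) = 0 := fun x => H _ (P1 x) (Pw x)
  let u : QuatAlg K g h := ⟨0, 0, 1, 0⟩
  have hu : P u ≠ 0 := by
    intro h0
    have hj := congrArg QuaternionAlgebra.imJ h0
    simp [P, u, bil, CharTwo.two_eq_zero] at hj
  obtain ⟨q, hq⟩ := exists_bil_ne_zero hg hu
  have e : bil (P u) (P q) = bil (P u) q := by
    simp only [P, bil_add_right, bil_smul_right]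
    rw [bil_comm _ 1, bil_comm _ w, P1 u, Pw u]
    ring
  have := H (P u + P q) (by rw [bil_add_right, P1, P1, add_zero])
    (by rw [bil_add_right, Pw, Pw, add_zero])
  rw [norm_add, hP, hP, e] at this
  exact hq (by simpa using this)

/-- A non-scalar element of trace zero is orthogonal to an element of trace one. -/
theorem exists_trace_one (hg : g ≠ 0) (z : QuatAlg K g h) (hz : bil 1 z = 0)
    (hz' : ∀ x : K, z ≠ x • 1) : ∃ w, bil 1 w = 1 ∧ bil w z = 0 := by
  have h2 : (2 : K) = 0 := CharTwo.two_eq_zero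
  have hi : z.imI = 0 := by simpa [bil, h2] using hz
  by_cases hj : z.imJ = 0
  · by_cases hk : z.imK = 0
    · exact (hz' z.re (by ext <;> simp [*])).elim
    · refine ⟨⟨0, 1, z.re / (g * z.imK), 0⟩, by simp [bil, h2], ?_⟩
      simp [bil, h2, hj]
      field_simp
      linear_combination z.re * h2
  · refine ⟨⟨0, 1, 0, z.re / (g * z.imJ)⟩, by simp [bil, h2], ?_⟩
    simp [bil, h2]
    field_simp
    linear_combination z.re * h2

/-- A presentation of the quaternion algebra by `w`, `z` yields one of its norm form. -/
theorem isometric_pf2 (w z : QuatAlg K g h) (hw : bil 1 w = 1) (hz : bil 1 z = 0)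
    (hwz : bil w z = 0) (hz0 : norm z ≠ 0) :
    QIsometric K (pf2 K g h) (pf2 K (norm z) (norm w)) := by
  let f : (Fin 4 → K) →ₗ[K] QuatAlg K g h :=
    { toFun := fun v => (v 0 • 1 + v 1 • w) + (v 2 • 1 + v 3 • w) * z
      map_add' := fun u v => by simp only [Pi.add_apply, add_smul, add_mul]; abel
      map_smul' := fun r v => by
        simp only [Pi.smul_apply, smul_eq_mul, mul_smul, add_mul, smul_mul_assoc, smul_add,
          RingHom.id_apply] }
  have hs : ∀ x y : K, norm (x • 1 + y • w) = x ^ 2 + x * y + norm w * y ^ 2 := fun x y => by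
    rw [norm_add, norm_smul, norm_smul, bil_smul_left, bil_smul_right, hw, norm_one]
    ring
  have hf : ∀ v, norm (f v) = pf2 K (norm z) (norm w) v := fun v => by
    change norm ((v 0 • 1 + v 1 • w) + (v 2 • 1 + v 3 • w) * z) = _
    rw [norm_add, bil_span_mul, norm_mul, hs, hs, hz, hwz, pf2_apply]
    ring
  have hfb : ∀ u v, bil (f u) (f v) =
      bil (ofTuple (norm z) (norm w) u) (ofTuple (norm z) (norm w) v) := fun u v => by
    have e₁ := norm_add (f u) (f v)
    have e₂ := norm_add (ofTuple (norm z) (norm w) u) (ofTuple (norm z) (norm w) v)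
    rw [← map_add, hf, hf, hf] at e₁
    rw [← map_add, norm_ofTuple, norm_ofTuple, norm_ofTuple] at e₂
    exact add_left_cancel (e₁.symm.trans e₂)
  have hinj : Function.Injective f := by
    rw [← LinearMap.ker_eq_bot, LinearMap.ker_eq_bot']
    intro v hv
    have : ofTuple (norm z) (norm w) v = 0 := eq_zero_of_bil hz0 fun q => by
      obtain ⟨u, rfl⟩ := (ofTuple (norm z) (norm w)).surjective q
      rw [← hfb, hv, bil_comm, bil_zero_right]
    simpa using this
  let e : (Fin 4 → K) ≃ₗ[K] (Fin 4 → K) :=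
    LinearEquiv.ofInjectiveEndo ((ofTuple g h).symm.toLinearMap ∘ₗ f)
      ((ofTuple g h).symm.injective.comp hinj)
  have he : ∀ v, pf2 K g h (e v) = pf2 K (norm z) (norm w) v := fun v => by
    rw [← norm_ofTuple, ← hf]
    simp [e]
  exact ⟨⟨e.symm, fun v => by
    change pf2 K (norm z) (norm w) (e.symm v) = _
    rw [← he, e.apply_symm_apply]⟩⟩

/-- An isotropic quaternion norm form splits off a hyperbolic plane. -/
theorem isometric_pf2_zero_of_isotropic (hg : g ≠ 0) {v : QuatAlg K g h} (hv : v ≠ 0)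
    (hv0 : norm v = 0) : ∃ k, k ≠ 0 ∧ QIsometric K (pf2 K g h) (pf2 K k 0) := by
  obtain ⟨q, hq⟩ := exists_bil_ne_zero hg hv
  have hb : bil 1 ((bil v q)⁻¹ • (q * star v)) = 1 := by
    rw [bil_smul_right, ← bil_mul_left, one_mul]
    exact inv_mul_cancel₀ hq
  have hs : norm (star v) = 0 := by
    rw [← hv0]
    simp [norm]; ring
  have hn : norm ((bil v q)⁻¹ • (q * star v)) = 0 := by
    rw [norm_smul, norm_mul, hs, mul_zero, mul_zero]
  obtain ⟨z, hz, hwz, hz0⟩ := exists_orthogonal hg _ hb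
  exact ⟨norm z, hz0, hn ▸ isometric_pf2 _ z hb hz hwz hz0⟩

end Field

end QuatAlg

theorem exists_isotropic_of_wittEquiv_zero {K : Type} [Field K] (q : QF K 4)
    (hq : WittEquiv K q (0 : QF K 0)) : ∃ v, v ≠ 0 ∧ q v = 0 := by
  obtain ⟨r, ρ, -, ⟨i, j, ⟨φ⟩⟩, ⟨i', j', ⟨ψ⟩⟩⟩ := hq
  have hd := ψ.toLinearEquiv.finrank_eq
  simp only [Module.finrank_fin_fun] at hd
  obtain rfl : r = 0 := by omega
  have hd' := φ.toLinearEquiv.finrank_eq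
  simp only [Module.finrank_fin_fun] at hd'
  let k : Fin (i * 2 + 0 + j) := ⟨0, by omega⟩
  refine ⟨φ.symm (Pi.single k 1), ?_, ?_⟩
  · intro h0
    have : (Pi.single k 1 : Fin (i * 2 + 0 + j) → K) = 0 := by
      rw [← φ.apply_symm_apply (Pi.single k 1), h0]
      exact map_zero φ.toLinearEquiv
    simpa using congrFun this k
  · rw [φ.symm.map_app, oSum_apply, oSum_apply, oSumFam_apply]
    have hρ : ∀ x, ρ x = 0 := fun x => by rw [Subsingleton.elim x 0, map_zero]
    rw [hρ, Finset.sum_eq_zero]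
    · simp [diagQF]
    · intro s _
      rw [binQF_apply]
      by_cases h0 : k = Fin.castAdd j (Fin.castAdd 0 (finProdFinEquiv (s, 0)))
      · have : k ≠ Fin.castAdd j (Fin.castAdd 0 (finProdFinEquiv (s, 1))) := by
          rw [h0]
          simp [Fin.ext_iff]
        rw [Pi.single_eq_of_ne this.symm]
        ring
      · rw [Pi.single_eq_of_ne (Ne.symm h0)]
        ring

theorem pf2_zero_wittEquiv {K : Type} [Field K] {k : K} (hk : k ≠ 0) {q : QF K 4}
    (hq : QIsometric K q (pf2 K k 0)) : WittEquiv K q (0 : QF K 0) := by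
  obtain ⟨φ⟩ := hq
  refine ⟨0, 0, fun x _ => Subsingleton.elim _ _, ⟨2, 0, ?_⟩, 0, 0, ?_⟩
  · let e : (Fin 4 → K) ≃ₗ[K] (Fin (2 * 2 + 0 + 0) → K) :=
      { toFun := fun v => ![v 0, v 0 + v 1, k * v 2, v 2 + v 3]
        invFun := fun v => ![v (0 : Fin 4), v (1 : Fin 4) - v (0 : Fin 4),
          k⁻¹ * v (2 : Fin 4), v (3 : Fin 4) - k⁻¹ * v (2 : Fin 4)]
        map_add' := fun u v => by
          ext i
          fin_cases i <;> simp <;> ring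
        map_smul' := fun r v => by
          ext i
          fin_cases i <;> simp <;> ring
        left_inv := fun v => by
          ext i
          fin_cases i <;> simp [hk]
        right_inv := fun v => by
          ext i
          fin_cases i <;> simp [hk] }
    refine ⟨φ.trans ⟨e, fun v => ?_⟩⟩
    change oSum K (oSum K (oSumFam K fun _ : Fin 2 => binQF K 0 0) 0) (diagQF K 0) (e v) = _
    rw [oSum_apply, oSum_apply, oSumFam_apply, Fin.sum_univ_two, binQF_apply, binQF_apply,
      pf2_apply]
    have e0 : ∀ (x : Fin 0 → K), diagQF K 0 x = 0 := fun x => by simp [diagQF]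
    have v0 : e v (Fin.castAdd 0 (Fin.castAdd 0 (finProdFinEquiv ((0 : Fin 2), (0 : Fin 2))))) =
        v 0 := rfl
    have v1 : e v (Fin.castAdd 0 (Fin.castAdd 0 (finProdFinEquiv ((0 : Fin 2), (1 : Fin 2))))) =
        v 0 + v 1 := rfl
    have v2 : e v (Fin.castAdd 0 (Fin.castAdd 0 (finProdFinEquiv ((1 : Fin 2), (0 : Fin 2))))) =
        k * v 2 := rfl
    have v3 : e v (Fin.castAdd 0 (Fin.castAdd 0 (finProdFinEquiv ((1 : Fin 2), (1 : Fin 2))))) =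
        v 2 + v 3 := rfl
    rw [e0, v0, v1, v2, v3, zero_apply]
    ring
  · let e : (Fin 0 → K) ≃ₗ[K] (Fin (0 * 2 + 0 + 0) → K) := LinearEquiv.ofFinrankEq _ _ (by simp)
    refine ⟨⟨e, fun v => ?_⟩⟩
    rw [Subsingleton.elim v 0]
    exact (congrArg _ (map_zero e)).trans (map_zero _)

theorem inWqKernel_pf2_iff {F E : Type} [Field F] [CharP F 2] [Field E] [Algebra F E] {g : F}
    (hg : g ≠ 0) (h : F) :
    InWqKernel F E (pf2 F g h) ↔
      ∃ v : QuatAlg E (algebraMap F E g) (algebraMap F E h), v ≠ 0 ∧ v.norm = 0 := by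
  have : CharP E 2 := charP_of_injective_algebraMap (algebraMap F E).injective 2
  rw [InWqKernel, extQF_pf2]
  constructor
  · intro H
    obtain ⟨v, hv, hv0⟩ := exists_isotropic_of_wittEquiv_zero _ H
    exact ⟨QuatAlg.ofTuple _ _ v, by simpa using hv, by rw [QuatAlg.norm_ofTuple, hv0]⟩
  · rintro ⟨v, hv, hv0⟩
    obtain ⟨k, hk, H⟩ := QuatAlg.isometric_pf2_zero_of_isotropic (by simpa using hg) hv hv0
    exact pf2_zero_wittEquiv hk H

namespace QuatAlg

section BaseChange
variable {K L : Type} [Field K] [Field L] [Algebra K L] {g h : K}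

/-- Extension of scalars to `L`. -/
def baseChange (L : Type) [Field L] [Algebra K L] (p : QuatAlg K g h) :
    QuatAlg L (algebraMap K L g) (algebraMap K L h) :=
  ⟨algebraMap K L p.re, algebraMap K L p.imI, algebraMap K L p.imJ, algebraMap K L p.imK⟩

theorem baseChange_add (p q : QuatAlg K g h) :
    baseChange L (p + q) = baseChange L p + baseChange L q := by
  ext <;> simp [baseChange]

theorem baseChange_smul (r : K) (p : QuatAlg K g h) :
    baseChange L (r • p) = algebraMap K L r • baseChange L p := by
  ext <;> simp [baseChange, Algebra.smul_def]

theorem baseChange_mul (p q : QuatAlg K g h) :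
    baseChange L (p * q) = baseChange L p * baseChange L q := by
  ext <;> simp [baseChange]

theorem baseChange_one : baseChange L (1 : QuatAlg K g h) = 1 := by
  ext <;> simp [baseChange]

theorem norm_baseChange (p : QuatAlg K g h) :
    norm (baseChange L p) = algebraMap K L (norm p) := by
  simp [baseChange, norm]

theorem bil_baseChange (p q : QuatAlg K g h) :
    bil (baseChange L p) (baseChange L q) = algebraMap K L (bil p q) := by
  simp [baseChange, bil, map_ofNat (algebraMap K L) 2]

theorem norm_linear (α : L) (p : QuatAlg K g h) :
    norm (α • 1 + (-1 : L) • baseChange L p) =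
      α ^ 2 - algebraMap K L (bil 1 p) * α + algebraMap K L (norm p) := by
  rw [← baseChange_one (K := K), norm_add, norm_smul, norm_smul, bil_smul_left, bil_smul_right,
    norm_baseChange, norm_baseChange, bil_baseChange, norm_one, map_one]
  ring

theorem norm_quadratic (α : L) (p q r : QuatAlg K g h) :
    norm (baseChange L p + α • baseChange L q + α ^ 2 • baseChange L r) =
      algebraMap K L (norm p) + algebraMap K L (bil p q) * α +
        algebraMap K L (norm q + bil p r) * α ^ 2 + algebraMap K L (bil q r) * α ^ 3 +
        algebraMap K L (norm r) * α ^ 4 := by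
  simp only [norm_add, norm_smul, bil_add_left, bil_smul_left, bil_smul_right, norm_baseChange,
    bil_baseChange, map_add]
  ring

end BaseChange

end QuatAlg

theorem quartic_linearIndependent {F E : Type} [Field F] [Field E] [Algebra F E] {α : E}
    (hdim : Module.finrank F E = 4) (hE : IntermediateField.adjoin F {α} = ⊤) :
    LinearIndependent F (fun i : Fin 4 => α ^ (i : ℕ)) := by
  have : FiniteDimensional F E := Module.finite_of_finrank_eq_succ hdim
  have hd := (Field.primitive_element_iff_minpoly_natDegree_eq F α).1 hE
  rw [hdim] at hd
  have := linearIndependent_pow (K := F) α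
  rwa [hd] at this

theorem quartic_coeff_eq_zero {F E : Type} [Field F] [Field E] [Algebra F E] {α : E}
    (hli : LinearIndependent F (fun i : Fin 4 => α ^ (i : ℕ))) {x₀ x₁ x₂ x₃ : F}
    (hx : algebraMap F E x₀ + algebraMap F E x₁ * α + algebraMap F E x₂ * α ^ 2
      + algebraMap F E x₃ * α ^ 3 = 0) : x₀ = 0 ∧ x₁ = 0 ∧ x₂ = 0 ∧ x₃ = 0 := by
  have := Fintype.linearIndependent_iff.1 hli ![x₀, x₁, x₂, x₃]
    (by simpa [Fin.sum_univ_four, Algebra.smul_def] using hx)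
  exact ⟨this 0, this 1, this 2, this 3⟩

theorem quartic_exists_coeff {F E : Type} [Field F] [Field E] [Algebra F E] {α : E}
    (hdim : Module.finrank F E = 4)
    (hli : LinearIndependent F (fun i : Fin 4 => α ^ (i : ℕ))) (y : E) :
    ∃ x : Fin 4 → F, y = algebraMap F E (x 0) + algebraMap F E (x 1) * α
      + algebraMap F E (x 2) * α ^ 2 + algebraMap F E (x 3) * α ^ 3 := by
  let B := basisOfLinearIndependentOfCardEqFinrank hli (by simp [hdim])
  refine ⟨B.repr y, ?_⟩
  conv_lhs => rw [← B.sum_repr y]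
  simp [Fin.sum_univ_four, Algebra.smul_def, B]

namespace QuatAlg

section Quartic
variable {F E : Type} [Field F] [Field E] [Algebra F E] {g h : F} {α : E} {a b c d : F}

theorem exists_isotropic_quadratic
    (hα : α ^ 4 + algebraMap F E a * α ^ 3 + algebraMap F E b * α ^ 2
        + algebraMap F E c * α + algebraMap F E d = 0)
    (hdim : Module.finrank F E = 4)
    (hli : LinearIndependent F (fun i : Fin 4 => α ^ (i : ℕ)))
    (haniso : ∀ p : QuatAlg F g h, norm p = 0 → p = 0)
    {v : QuatAlg E (algebraMap F E g) (algebraMap F E h)} (hv : v ≠ 0) (hv0 : norm v = 0) :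
    ∃ p q r : QuatAlg F g h,
      baseChange E p + α • baseChange E q + α ^ 2 • baseChange E r ≠ 0 ∧
      norm (baseChange E p + α • baseChange E q + α ^ 2 • baseChange E r) = 0 := by
  obtain ⟨x, hx⟩ := quartic_exists_coeff hdim hli v.re
  obtain ⟨y, hy⟩ := quartic_exists_coeff hdim hli v.imI
  obtain ⟨z, hz⟩ := quartic_exists_coeff hdim hli v.imJ
  obtain ⟨t, ht⟩ := quartic_exists_coeff hdim hli v.imK
  let u : Fin 4 → QuatAlg F g h := fun i => ⟨x i, y i, z i, t i⟩
  have hu : v = baseChange E (u 0) + α • baseChange E (u 1) + α ^ 2 • baseChange E (u 2)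
      + α ^ 3 • baseChange E (u 3) := by
    ext <;> simp [baseChange, u, *] <;> ring
  by_cases h3 : u 3 = 0
  · have e : v = baseChange E (u 0) + α • baseChange E (u 1) + α ^ 2 • baseChange E (u 2) := by
      rw [hu, h3]
      ext <;> simp [baseChange]
    exact ⟨u 0, u 1, u 2, e ▸ hv, e ▸ hv0⟩
  · have hn : norm (u 3) ≠ 0 := fun h0 => h3 (haniso _ h0)
    let s : QuatAlg F g h := (norm (u 3))⁻¹ • star (u 3)
    have hs : s * u 3 = 1 := by
      rw [smul_mul_assoc, star_mul_self_eq, smul_smul, inv_mul_cancel₀ hn, one_smul]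
    have hs' : baseChange E s * v = baseChange E (s * u 0) + α • baseChange E (s * u 1)
        + α ^ 2 • baseChange E (s * u 2) + α ^ 3 • 1 := by
      rw [← baseChange_one, ← hs, hu]
      simp only [mul_add, mul_smul_comm, baseChange_mul]
    let m : QuatAlg F g h := s * u 2 + (-a) • 1
    let l : QuatAlg E (algebraMap F E g) (algebraMap F E h) := α • 1 + (-1 : E) • baseChange E m
    have key : l * (baseChange E s * v) =
        baseChange E ((-d) • 1 + (-1 : F) • (m * (s * u 0))) +
        α • baseChange E (s * u 0 + (-c) • 1 + (-1 : F) • (m * (s * u 1))) +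
        α ^ 2 • baseChange E (s * u 1 + (-b) • 1 + (-1 : F) • (m * (s * u 2))) := by
      have h4 : α ^ 4 = -(algebraMap F E a * α ^ 3 + algebraMap F E b * α ^ 2
        + algebraMap F E c * α + algebraMap F E d) := by linear_combination hα
      have hm : baseChange E m = baseChange E (s * u 2) + (-algebraMap F E a) • 1 := by
        rw [baseChange_add, baseChange_smul, baseChange_one, map_neg]
      have e : l * (α ^ 3 • 1) = α ^ 4 • 1 - α ^ 3 • baseChange E (s * u 2)
          + (α ^ 3 * algebraMap F E a) • 1 := by
        simp only [l, hm, mul_smul_comm, mul_one]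
        module
      rw [hs', mul_add, e, h4]
      simp only [l, baseChange_add, baseChange_smul, baseChange_one, baseChange_mul m, add_mul,
        mul_add, smul_mul_assoc, mul_smul_comm, one_mul, map_neg, map_one]
      module
    have hl : norm l ≠ 0 := by
      intro h0
      have := quartic_coeff_eq_zero hli (x₀ := norm m) (x₁ := -bil 1 m) (x₂ := 1) (x₃ := 0) (by
        rw [norm_linear] at h0
        simp only [map_neg, map_one, map_zero]
        linear_combination h0)
      exact one_ne_zero this.2.2.1
    have cancel : ∀ {p q : QuatAlg E (algebraMap F E g) (algebraMap F E h)},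
        norm p ≠ 0 → q ≠ 0 → p * q ≠ 0 := by
      intro p q hp hq h0
      have := congrArg (star p * ·) h0
      simp only [← mul_assoc, star_mul_self_eq, mul_zero, smul_mul_assoc, one_mul] at this
      exact (smul_ne_zero hp hq) this
    have hsn : norm (baseChange E s) ≠ 0 := by
      rw [norm_baseChange]
      intro h0
      have := congrArg norm hs
      rw [norm_mul, (map_eq_zero _).1 h0, norm_one, zero_mul] at this
      exact zero_ne_one this
    refine ⟨_, _, _, key ▸ cancel hl (cancel hsn hv), ?_⟩
    rw [← key, norm_mul, norm_mul, hv0, mul_zero, mul_zero]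

/-- If a division quaternion algebra is split by the quartic extension, then the quartic polynomial
is the reduced norm of a monic quadratic polynomial over the algebra. -/
theorem exists_norm_factorization
    (hα : α ^ 4 + algebraMap F E a * α ^ 3 + algebraMap F E b * α ^ 2
        + algebraMap F E c * α + algebraMap F E d = 0)
    (hdim : Module.finrank F E = 4)
    (hli : LinearIndependent F (fun i : Fin 4 => α ^ (i : ℕ)))
    (haniso : ∀ p : QuatAlg F g h, norm p = 0 → p = 0)
    {v : QuatAlg E (algebraMap F E g) (algebraMap F E h)} (hv : v ≠ 0) (hv0 : norm v = 0) :
    ∃ p q : QuatAlg F g h,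
      bil 1 q = a ∧ norm q + bil 1 p = b ∧ bil p q = c ∧ norm p = d := by
  obtain ⟨p, q, r, hne, h0⟩ := exists_isotropic_quadratic hα hdim hli haniso hv hv0
  have hr : norm r ≠ 0 := by
    intro hr
    obtain rfl := haniso r hr
    rw [norm_quadratic] at h0
    simp only [bil_zero_right, norm_zero, add_zero] at h0
    obtain ⟨hp, -, hq, -⟩ := quartic_coeff_eq_zero hli (x₃ := 0) (by simpa using h0)
    obtain rfl := haniso p hp
    obtain rfl := haniso q hq
    exact hne (by ext <;> simp [baseChange])
  let s : QuatAlg F g h := (norm r)⁻¹ • star r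
  have hs : s * r = 1 := by
    rw [smul_mul_assoc, star_mul_self_eq, smul_smul, inv_mul_cancel₀ hr, one_smul]
  have h1 : norm (baseChange E (s * p) + α • baseChange E (s * q)
      + α ^ 2 • baseChange E (1 : QuatAlg F g h)) = 0 := by
    rw [← hs]
    simp only [baseChange_mul, ← mul_smul_comm, ← mul_add]
    rw [norm_mul, h0, mul_zero]
  rw [norm_quadratic, norm_one, map_one, one_mul] at h1
  obtain ⟨hd, hc, hb, ha⟩ := quartic_coeff_eq_zero hli (x₀ := norm (s * p) - d)
    (x₁ := bil (s * p) (s * q) - c) (x₂ := norm (s * q) + bil (s * p) 1 - b)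
    (x₃ := bil (s * q) 1 - a) (by
      simp only [map_sub]
      linear_combination h1 - hα)
  refine ⟨s * p, s * q, ?_, ?_, sub_eq_zero.1 hc, sub_eq_zero.1 hd⟩
  · rw [bil_comm, sub_eq_zero.1 ha]
  · rw [bil_comm 1, sub_eq_zero.1 hb]

end Quartic

end QuatAlg

namespace QuatAlg

section Isometry
variable {K L : Type} [Field K] [Field L] [Algebra K L] {g h g' h' : K}

theorem norm_sum_four (x y z t : L) (p q r s : QuatAlg K g h) :
    norm (x • baseChange L p + y • baseChange L q + z • baseChange L r + t • baseChange L s) =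
      x ^ 2 * algebraMap K L (norm p) + y ^ 2 * algebraMap K L (norm q) +
        z ^ 2 * algebraMap K L (norm r) + t ^ 2 * algebraMap K L (norm s) +
        x * y * algebraMap K L (bil p q) + x * z * algebraMap K L (bil p r) +
        x * t * algebraMap K L (bil p s) + y * z * algebraMap K L (bil q r) +
        y * t * algebraMap K L (bil q s) + z * t * algebraMap K L (bil r s) := by
  simp only [norm_add, norm_smul, bil_add_left, bil_smul_left, bil_smul_right, norm_baseChange,
    bil_baseChange]
  ring

/-- Isotropy over an extension only depends on the isometry class of the form. -/
theorem exists_isotropic_of_isometric [CharP K 2] (hg' : g' ≠ 0)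
    (H : QIsometric K (pf2 K g h) (pf2 K g' h'))
    {v : QuatAlg L (algebraMap K L g') (algebraMap K L h')} (hv : v ≠ 0) (hv0 : norm v = 0) :
    ∃ w : QuatAlg L (algebraMap K L g) (algebraMap K L h), w ≠ 0 ∧ norm w = 0 := by
  have : CharP L 2 := charP_of_injective_algebraMap (algebraMap K L).injective 2
  obtain ⟨φ⟩ := H
  let f : QuatAlg K g' h' →ₗ[K] QuatAlg K g h :=
    (ofTuple g h).toLinearMap ∘ₗ φ.symm.toLinearEquiv.toLinearMap ∘ₗ
      (ofTuple g' h').symm.toLinearMap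
  have hf : ∀ p, norm (f p) = norm p := fun p => by
    obtain ⟨u, rfl⟩ := (ofTuple g' h').surjective p
    change norm (ofTuple g h (φ.symm ((ofTuple g' h').symm (ofTuple g' h' u)))) = _
    rw [norm_ofTuple, LinearEquiv.symm_apply_apply, φ.symm.map_app, norm_ofTuple]
  have hfb : ∀ p q, bil (f p) (f q) = bil p q := fun p q => by
    have e := norm_add (f p) (f q)
    rw [← map_add, hf, hf, hf, norm_add] at e
    exact (add_left_cancel e).symm
  let ψ : QuatAlg L (algebraMap K L g') (algebraMap K L h') →
      QuatAlg L (algebraMap K L g) (algebraMap K L h) := fun u =>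
    u.re • baseChange L (f ⟨1, 0, 0, 0⟩) + u.imI • baseChange L (f ⟨0, 1, 0, 0⟩) +
      u.imJ • baseChange L (f ⟨0, 0, 1, 0⟩) + u.imK • baseChange L (f ⟨0, 0, 0, 1⟩)
  have hψ : ∀ u, norm (ψ u) = norm u := fun u => by
    have e : u = u.re • baseChange L (⟨1, 0, 0, 0⟩ : QuatAlg K g' h') +
        u.imI • baseChange L (⟨0, 1, 0, 0⟩ : QuatAlg K g' h') +
        u.imJ • baseChange L (⟨0, 0, 1, 0⟩ : QuatAlg K g' h') +
        u.imK • baseChange L (⟨0, 0, 0, 1⟩ : QuatAlg K g' h') := by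
      ext <;> simp [baseChange]
    conv_rhs => rw [e]
    simp only [ψ, norm_sum_four, hf, hfb]
  have hψa : ∀ u w, ψ (u + w) = ψ u + ψ w := fun u w => by
    simp only [ψ, QuaternionAlgebra.re_add, QuaternionAlgebra.imI_add, QuaternionAlgebra.imJ_add,
      QuaternionAlgebra.imK_add]
    module
  refine ⟨ψ v, fun h0 => hv (eq_zero_of_bil (by simpa using hg') fun q => ?_), by rw [hψ, hv0]⟩
  have e := norm_add (ψ v) (ψ q)
  rw [← hψa, hψ, hψ, hψ, norm_add, h0, bil_comm 0, bil_zero_right] at e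
  exact add_left_cancel e

end Isometry

end QuatAlg

theorem inWqKernel_of_isometric {F E : Type} [Field F] [CharP F 2] [Field E] [Algebra F E]
    {g h g' h' : F} (hg : g ≠ 0) (hg' : g' ≠ 0) (H : QIsometric F (pf2 F g h) (pf2 F g' h'))
    {v : QuatAlg E (algebraMap F E g') (algebraMap F E h')} (hv : v ≠ 0) (hv0 : v.norm = 0) :
    InWqKernel F E (pf2 F g h) :=
  (inWqKernel_pf2_iff hg h).2 (QuatAlg.exists_isotropic_of_isometric hg' H hv hv0)

theorem exists_of_trace_ne_zero {F E : Type} [Field F] [CharP F 2] [Field E] [Algebra F E]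
    {a b c d g h : F} {α : E} (hg : g ≠ 0)
    (hα : α ^ 4 + algebraMap F E a * α ^ 3 + algebraMap F E b * α ^ 2
        + algebraMap F E c * α + algebraMap F E d = 0)
    (hlin : ∀ x e : F, e ≠ 0 → algebraMap F E x * α + algebraMap F E e ≠ 0)
    (p q : QuatAlg F g h) (ha : QuatAlg.bil 1 q = a) (hb : q.norm + QuatAlg.bil 1 p = b)
    (hc : p.bil q = c) (hd : p.norm = d) (he : QuatAlg.bil 1 p ≠ 0) :
    (∃ h' g' : F, h' ≠ 0 ∧ (∃ β : E, β ^ 2 + β + algebraMap F E g' = 0) ∧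
        QIsometric F (pf2 F g h) (pf2 F h' g')) ∨
      ∃ e : F, e ≠ 0 ∧ cubicResolvent F a b c d e ≠ 0 ∧
        QIsometric F (pf2 F g h) (pf2 F (cubicResolvent F a b c d e) (d / e ^ 2)) := by
  have h2 : (2 : F) = 0 := CharTwo.two_eq_zero
  have : CharP E 2 := charP_of_injective_algebraMap (algebraMap F E).injective 2
  have h2E : (2 : E) = 0 := CharTwo.two_eq_zero
  generalize hep : QuatAlg.bil 1 p = e at *
  have hw : QuatAlg.bil 1 (e⁻¹ • p) = 1 := by
    rw [QuatAlg.bil_smul_right, hep, inv_mul_cancel₀ he]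
  have hnw : (e⁻¹ • p).norm = d / e ^ 2 := by
    rw [QuatAlg.norm_smul, hd]
    field_simp
  have hz : QuatAlg.bil 1 (e • q + c • 1 + a • p) = 0 := by
    simp only [QuatAlg.bil_add_right, QuatAlg.bil_smul_right, QuatAlg.bil_self_eq_zero, ha, hep]
    linear_combination e * a * h2
  have hwz : (e⁻¹ • p).bil (e • q + c • 1 + a • p) = 0 := by
    simp only [QuatAlg.bil_add_right, QuatAlg.bil_smul_right, QuatAlg.bil_smul_left,
      QuatAlg.bil_self_eq_zero, hc, p.bil_comm 1, hep]
    linear_combination e⁻¹ * e * c * h2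
  have hnz : (e • q + c • 1 + a • p).norm = cubicResolvent F a b c d e := by
    simp only [QuatAlg.norm_add, QuatAlg.norm_smul, QuatAlg.bil_add_left, QuatAlg.bil_smul_right,
      QuatAlg.bil_smul_left, QuatAlg.norm_one, q.bil_comm 1, q.bil_comm p, hc, ha, hep, hd,
      cubicResolvent]
    linear_combination e ^ 2 * hb + (e * c * a - e ^ 3) * h2
  by_cases hf : cubicResolvent F a b c d e = 0
  · obtain ⟨z, hz₁, hz₂, hz₃⟩ := QuatAlg.exists_orthogonal hg _ hw
    refine Or.inl ⟨z.norm, d / e ^ 2, hz₃, ⟨(algebraMap F E e * α ^ 2 + algebraMap F E c * α) /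
      (algebraMap F E e * (algebraMap F E a * α + algebraMap F E e)), ?_⟩,
      hnw ▸ QuatAlg.isometric_pf2 _ z hw hz₁ hz₂ hz₃⟩
    have he' : algebraMap F E e ≠ 0 := by simpa using he
    have hl : α * algebraMap F E a + algebraMap F E e ≠ 0 := by
      rw [mul_comm]
      exact hlin a e he
    have hf' := congrArg (algebraMap F E) hf
    simp only [cubicResolvent, map_add, map_mul, map_pow, map_zero] at hf'
    simp only [map_div₀, map_pow]
    field_simp
    linear_combination algebraMap F E e ^ 2 * hα + α ^ 2 * hf' + h2E *
      (algebraMap F E e * algebraMap F E c * α ^ 3 +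
        algebraMap F E d * algebraMap F E a * algebraMap F E e * α -
        algebraMap F E b * algebraMap F E e ^ 2 * α ^ 2)
  · exact Or.inr ⟨e, he, hf, hnw ▸ hnz ▸ QuatAlg.isometric_pf2 _ _ hw hz hwz (hnz ▸ hf)⟩

theorem exists_sqrt_of_trace_zero {F E : Type} [Field F] [CharP F 2] [Field E] [Algebra F E]
    {a b c d g h : F} {α : E} (hg : g ≠ 0)
    (hα : α ^ 4 + algebraMap F E a * α ^ 3 + algebraMap F E b * α ^ 2
        + algebraMap F E c * α + algebraMap F E d = 0)
    (hli : LinearIndependent F (fun i : Fin 4 => α ^ (i : ℕ)))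
    (hnorm : (b = 0 ∧ a ≠ 0) ∨ (a = 0 ∧ c = 0 ∧ b ≠ 0) ∨ (a = 0 ∧ b = 0 ∧ c = 0))
    (haniso : ∀ p : QuatAlg F g h, p.norm = 0 → p = 0)
    (p q : QuatAlg F g h) (ha : QuatAlg.bil 1 q = a) (hb : q.norm = b)
    (hc : p.bil q = c) (hd : p.norm = d) (he : QuatAlg.bil 1 p = 0) :
    ∃ g' h' : F, g' ≠ 0 ∧ (∃ β : E, β ^ 2 = algebraMap F E g') ∧
      QIsometric F (pf2 F g h) (pf2 F g' h') := by
  have h2 : (2 : F) = 0 := CharTwo.two_eq_zero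
  have : CharP E 2 := charP_of_injective_algebraMap (algebraMap F E).injective 2
  have h2E : (2 : E) = 0 := CharTwo.two_eq_zero
  have hac : a = 0 ∧ c = 0 := by
    rcases hnorm with ⟨hb0, ha0⟩ | ⟨ha0, hc0, -⟩ | ⟨ha0, -, hc0⟩
    · rw [haniso q (hb.trans hb0), QuatAlg.bil_zero_right] at ha
      exact (ha0 ha.symm).elim
    · exact ⟨ha0, hc0⟩
    · exact ⟨ha0, hc0⟩
  obtain ⟨rfl, rfl⟩ := hac
  simp only [map_zero, zero_mul, add_zero] at hα
  have hpure : ∀ z : QuatAlg F g h, QuatAlg.bil 1 z = 0 → (∀ x : F, z ≠ x • 1) →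
      (∃ β : E, β ^ 2 = algebraMap F E z.norm) →
      ∃ g' h' : F, g' ≠ 0 ∧ (∃ β : E, β ^ 2 = algebraMap F E g') ∧
        QIsometric F (pf2 F g h) (pf2 F g' h') := by
    intro z hz hns hβ
    have hz0 : z.norm ≠ 0 := fun h0 => hns 0 (by rw [haniso z h0, zero_smul])
    obtain ⟨w, hw, hwz⟩ := QuatAlg.exists_trace_one hg z hz hns
    exact ⟨z.norm, w.norm, hz0, hβ, QuatAlg.isometric_pf2 w z hw hz hwz hz0⟩
  by_cases hq : ∃ x : F, q = x • 1
  · obtain ⟨x, hx⟩ := hq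
    have hbx : b = x ^ 2 := by rw [← hb, hx, QuatAlg.norm_smul, QuatAlg.norm_one, mul_one]
    have hsq : (α ^ 2 + algebraMap F E x * α) ^ 2 = algebraMap F E d := by
      rw [hbx, map_pow] at hα
      linear_combination hα + (algebraMap F E x * α ^ 3 - algebraMap F E d) * h2E
    refine hpure p he (fun y hy => ?_) ⟨_, hsq.trans (by rw [hd])⟩
    have hdy : d = y ^ 2 := by rw [← hd, hy, QuatAlg.norm_smul, QuatAlg.norm_one, mul_one]
    have h0 : α ^ 2 + algebraMap F E x * α + algebraMap F E y = 0 := by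
      refine pow_eq_zero_iff two_ne_zero |>.1 ?_
      rw [CharTwo.add_sq, hsq, hdy, map_pow]
      exact CharTwo.add_self_eq_zero _
    exact one_ne_zero (quartic_coeff_eq_zero hli (x₀ := y) (x₁ := x) (x₂ := 1) (x₃ := 0)
      (by simp only [map_zero, map_one]; linear_combination h0)).2.2.1
  · push Not at hq
    refine hpure q ha hq ?_
    have hpI : p.imI = 0 := by simpa [QuatAlg.bil, h2] using he
    have hqI : q.imI = 0 := by simpa [QuatAlg.bil, h2] using ha
    have hJK : p.imJ * q.imK + p.imK * q.imJ = 0 := by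
      simpa [QuatAlg.bil, h2, hpI, hqI, hg] using hc
    obtain ⟨x, y, hxy⟩ : ∃ x y : F, p = x • 1 + y • q := by
      by_cases hj : q.imJ = 0
      · have hk : q.imK ≠ 0 := fun hk => hq q.re (by ext <;> simp [*])
        have hpJ : p.imJ = 0 := by simpa [hj, hk] using hJK
        exact ⟨p.re - p.imK / q.imK * q.re, p.imK / q.imK, by ext <;> simp [*]⟩
      · refine ⟨p.re - p.imJ / q.imJ * q.re, p.imJ / q.imJ, ?_⟩
        ext <;> simp [hpI, hqI, hj]
        field_simp
        linear_combination hJK - p.imJ * q.imK * h2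
    have hdxy : d = x ^ 2 + y ^ 2 * b := by
      rw [← hd, hxy, QuatAlg.norm_add, QuatAlg.norm_smul, QuatAlg.norm_smul, QuatAlg.norm_one,
        QuatAlg.bil_smul_left, QuatAlg.bil_smul_right, ha, hb]
      ring
    have hl : α + algebraMap F E y ≠ 0 := fun h0 =>
      one_ne_zero (quartic_coeff_eq_zero hli (x₀ := y) (x₁ := 1) (x₂ := 0) (x₃ := 0)
        (by simp only [map_zero, map_one]; linear_combination h0)).2.1
    refine ⟨(α ^ 2 + algebraMap F E x) / (α + algebraMap F E y), ?_⟩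
    rw [hdxy, map_add, map_mul, map_pow, map_pow] at hα
    rw [hb, div_pow, div_eq_iff (pow_ne_zero 2 hl), CharTwo.add_sq, CharTwo.add_sq]
    linear_combination hα - algebraMap F E b * (α ^ 2 + algebraMap F E y ^ 2) * h2E

/-- for a simple quartic extension `E = F(α)` in characteristic 2 with normalized
minimal polynomial `f(X) = X⁴ + aX³ + bX² + cX + d` and cubic resolvent `f_C`, a 2-fold
quadratic Pfister form `⟨⟨g,h]]` has Witt class in `W_q(E/F)` iff it is isometric to a form of
one of the types (a') `⟨⟨h',g']]` with `h' ∈ F*` and `F(℘⁻¹(g')) ⊆ E`; (b) `⟨⟨g',h']]` with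
`g' ∈ F*` and `F(√g') ⊆ E`; (c) `⟨⟨f_C(e), d/e²]]` with `e ∈ F*`, `f_C(e) ≠ 0`. -/
theorem stmt_8 (F : Type) [Field F] [CharP F 2] (E : Type) [Field E] [Algebra F E]
    (a b c d : F) (α : E)
    (hα : α ^ 4 + algebraMap F E a * α ^ 3 + algebraMap F E b * α ^ 2
        + algebraMap F E c * α + algebraMap F E d = 0)
    (hdim : Module.finrank F E = 4)
    (hE : IntermediateField.adjoin F {α} = ⊤)
    (hnorm : (b = 0 ∧ a ≠ 0) ∨ (a = 0 ∧ c = 0 ∧ b ≠ 0) ∨ (a = 0 ∧ b = 0 ∧ c = 0))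
    (g h : F) (hg : g ≠ 0) :
    InWqKernel F E (pf2 F g h) ↔
      ((∃ h' g' : F, h' ≠ 0 ∧ (∃ β : E, β ^ 2 + β + algebraMap F E g' = 0) ∧
          QIsometric F (pf2 F g h) (pf2 F h' g')) ∨
       (∃ g' h' : F, g' ≠ 0 ∧ (∃ β : E, β ^ 2 = algebraMap F E g') ∧
          QIsometric F (pf2 F g h) (pf2 F g' h')) ∨
       (∃ e : F, e ≠ 0 ∧ cubicResolvent F a b c d e ≠ 0 ∧
          QIsometric F (pf2 F g h) (pf2 F (cubicResolvent F a b c d e) (d / e ^ 2)))) := by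
  have : CharP E 2 := charP_of_injective_algebraMap (algebraMap F E).injective 2
  have h2E : (2 : E) = 0 := CharTwo.two_eq_zero
  have hli := quartic_linearIndependent hdim hE
  have hlin : ∀ x e : F, e ≠ 0 → algebraMap F E x * α + algebraMap F E e ≠ 0 := fun x e he h0 =>
    he (quartic_coeff_eq_zero hli (x₀ := e) (x₁ := x) (x₂ := 0) (x₃ := 0)
      (by simp only [map_zero]; linear_combination h0)).1
  constructor
  · intro H
    obtain ⟨v, hv, hv0⟩ := (inWqKernel_pf2_iff hg h).1 H
    by_cases haniso : ∀ p : QuatAlg F g h, p.norm = 0 → p = 0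
    swap
    · push Not at haniso
      obtain ⟨p, hp0, hp⟩ := haniso
      obtain ⟨k, hk, hiso⟩ := QuatAlg.isometric_pf2_zero_of_isotropic hg hp hp0
      exact Or.inl ⟨k, 0, hk, ⟨0, by simp⟩, hiso⟩
    obtain ⟨p, q, ha, hb, hc, hd⟩ :=
      QuatAlg.exists_norm_factorization hα hdim hli haniso hv hv0
    by_cases he : QuatAlg.bil 1 p = 0
    · exact Or.inr (Or.inl (exists_sqrt_of_trace_zero hg hα hli hnorm haniso p q ha
        (by rw [← hb, he, add_zero]) hc hd he))
    · exact (exists_of_trace_ne_zero hg hα hlin p q ha hb hc hd he).imp_right Or.inr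
  · rintro (⟨h', g', hh', ⟨β, hβ⟩, hiso⟩ | ⟨g', h', hg', ⟨β, hβ⟩, hiso⟩ | ⟨e, he, hfe, hiso⟩)
    · refine inWqKernel_of_isometric (E := E) hg hh' hiso (v := ⟨β, 1, 0, 0⟩)
        (fun h0 => one_ne_zero (congrArg QuaternionAlgebra.imI h0)) ?_
      simpa [QuatAlg.norm] using hβ
    · refine inWqKernel_of_isometric (E := E) hg hg' hiso (v := ⟨β, 0, 1, 0⟩)
        (fun h0 => one_ne_zero (congrArg QuaternionAlgebra.imJ h0)) ?_
      simp only [QuatAlg.norm, hβ]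
      linear_combination algebraMap F E g' * h2E
    · refine inWqKernel_of_isometric (E := E) hg hfe hiso
        (v := ⟨α ^ 2 + algebraMap F E (c / e) * α, algebraMap F E a * α + algebraMap F E e,
          α / algebraMap F E e, 0⟩)
        (fun h0 => hlin a e he (congrArg QuaternionAlgebra.imI h0)) ?_
      have he' : algebraMap F E e ≠ 0 := by simpa using he
      simp only [QuatAlg.norm, cubicResolvent, map_add, map_mul, map_pow, map_div₀]
      field_simp
      linear_combination algebraMap F E e ^ 2 * hα + h2E *
        (algebraMap F E e * algebraMap F E a * algebraMap F E d * α +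
        algebraMap F E e * algebraMap F E c * algebraMap F E a * α ^ 2 +
        algebraMap F E e ^ 3 * α ^ 2 +
        algebraMap F E c ^ 2 * α ^ 2 + algebraMap F E a ^ 2 * algebraMap F E d * α ^ 2 +
        algebraMap F E e * algebraMap F E c * α ^ 3)
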